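/- If the reverse channel P_{X|Y} is binary-input symmetric-output (BISO) and Y is uniform on {0,1} (i.e., Y ~ Bernoulli(1/2)), then for every ε ≥ 0, g_ε(X;Y) = min{ε, I(X;Y)} / I(X;Y). -/

import Mathlib

open scoped BigOperators

noncomputable section

namespace RatePrivacy

variable {α β γ : Type*}

/-- `p` is a probability mass function on a finite alphabet. -/
def IsPMF [Fintype α] (p : α → ℝ) : Prop := (∀ a, 0 ≤ p a) ∧ ∑ a, p a = 1

/-- Shannon entropy (in bits) of the distribution `p`. -/
def ent [Fintype α] (p : α → ℝ) : ℝ := ∑ a, -(p a * Real.logb 2 (p a))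

/-- First marginal of a joint distribution. -/
def margA [Fintype α] [Fintype β] (p : α × β → ℝ) : α → ℝ := fun a => ∑ b, p (a, b)

/-- Second marginal of a joint distribution. -/
def margB [Fintype α] [Fintype β] (p : α × β → ℝ) : β → ℝ := fun b => ∑ a, p (a, b)

/-- Mutual information (in bits) of a joint distribution `p`:
`I(A;B) = H(A) + H(B) - H(A,B)`. -/
def mi [Fintype α] [Fintype β] (p : α × β → ℝ) : ℝ :=
  ent (margA p) + ent (margB p) - ent p

/-- `q` is a (row-stochastic) channel. -/
def IsChannel [Fintype γ] (q : β → γ → ℝ) : Prop :=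
  (∀ y z, 0 ≤ q y z) ∧ ∀ y, ∑ z, q y z = 1

/-- Joint distribution of `(X, Z)` when `Z` is obtained from `Y` through the channel `q`
(so that `X — Y — Z` is a Markov chain). -/
def jointXZ [Fintype α] [Fintype β] [Fintype γ] (p : α × β → ℝ) (q : β → γ → ℝ) :
    α × γ → ℝ := fun xz => ∑ y, p (xz.1, y) * q y xz.2

/-- Joint distribution of `(Y, Z)` when `Z` is obtained from `Y` through the channel `q`. -/
def jointYZ [Fintype α] [Fintype β] [Fintype γ] (p : α × β → ℝ) (q : β → γ → ℝ) :
    β × γ → ℝ := fun yz => margB p yz.1 * q yz.1 yz.2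

/-- Achievable rates `I(Y;Z)` over all privacy filters `Z` (on finite alphabets, wlog `Fin n`)
with `X — Y — Z` Markov and `I(X;Z) ≤ ε`. -/
def gSet [Fintype α] [Fintype β] (p : α × β → ℝ) (ε : ℝ) : Set ℝ :=
  { r | ∃ (n : ℕ) (q : β → Fin n → ℝ), IsChannel q ∧
        mi (jointXZ p q) ≤ ε ∧ r = mi (jointYZ p q) }

/-- The rate-privacy function `g_ε(X;Y)` (privacy measured by mutual information). -/
def g [Fintype α] [Fintype β] (p : α × β → ℝ) (ε : ℝ) : ℝ := sSup (gSet p ε)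

/-- Values `E[f(A) g(B)]` over all zero-mean unit-variance `f, g`, used to define
the Hirschfeld–Gebelein–Rényi maximal correlation. -/
def corrSet [Fintype α] [Fintype β] (p : α × β → ℝ) : Set ℝ :=
  { r | ∃ (f : α → ℝ) (g : β → ℝ),
      (∑ a, margA p a * f a = 0) ∧ (∑ b, margB p b * g b = 0) ∧
      (∑ a, margA p a * (f a) ^ 2 = 1) ∧ (∑ b, margB p b * (g b) ^ 2 = 1) ∧
      r = ∑ x : α × β, p x * (f x.1 * g x.2) }

/-- Maximal correlation `ρ_m(A;B)` (equal to `0` when the constraint set is empty,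
since `sSup ∅ = 0` in `ℝ`). -/
def rhoM [Fintype α] [Fintype β] (p : α × β → ℝ) : ℝ := sSup (corrSet p)

/-- Achievable rates with maximal-correlation privacy constraint `ρ_m²(X;Z) ≤ ε`. -/
def ghSet [Fintype α] [Fintype β] (p : α × β → ℝ) (ε : ℝ) : Set ℝ :=
  { r | ∃ (n : ℕ) (q : β → Fin n → ℝ), IsChannel q ∧
        (rhoM (jointXZ p q)) ^ 2 ≤ ε ∧ r = mi (jointYZ p q) }

/-- The rate-privacy function `ĝ_ε(X;Y)` (privacy measured by squared maximal correlation). -/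
def gh [Fintype α] [Fintype β] (p : α × β → ℝ) (ε : ℝ) : ℝ := sSup (ghSet p ε)

/-- The Kullback–Leibler divergence (in bits) `D(P_{X|Y}(·|y) ‖ P_X)`. -/
def Dxy [Fintype α] [Fintype β] (p : α × β → ℝ) (y : β) : ℝ :=
  ∑ x, (p (x, y) / margB p y) * Real.logb 2 ((p (x, y) / margB p y) / margA p x)

/-- The alphabet `𝒳 = {0, ±1, …, ±k}` of a BISO channel output. -/
abbrev Xk (k : ℕ) : Type := {x : ℤ // x ∈ Finset.Icc (-(k : ℤ)) (k : ℤ)}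

/-- Negation on the alphabet `{0, ±1, …, ±k}`. -/
def negXk {k : ℕ} (x : Xk k) : Xk k :=
  ⟨-x.1, by
    have := x.2
    simp only [Finset.mem_Icc] at this ⊢
    omega⟩

/-- The reverse channel `P_{X|Y}` of the joint distribution `p` is binary-input
symmetric-output (BISO): `P_{X|Y}(x|1) = P_{X|Y}(−x|0)` for all `x`.
(Here `Y = true` plays the role of `1` and `Y = false` that of `0`.) -/
def IsBISO {k : ℕ} (p : Xk k × Bool → ℝ) : Prop :=
  ∀ x : Xk k, p (x, true) / margB p true = p (negXk x, false) / margB p false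

/-- The capacity of the reverse channel `P_{X|Y}` (maximal mutual information over input
distributions `w` on `{0,1}`). -/
def capacity {k : ℕ} (p : Xk k × Bool → ℝ) : ℝ :=
  sSup { r | ∃ w : Bool → ℝ, (∀ b, 0 ≤ w b) ∧ (∑ b, w b = 1) ∧
      r = mi (fun xb : Xk k × Bool => (p (xb.1, xb.2) / margB p xb.2) * w xb.2) }

open Real in
/-- The deficit `log 2 - H` (in nats) of the entropy of a binary distribution with bias `s`. -/
def biasDeficit (s : ℝ) : ℝ := log 2 - binEntropy ((1 + s) / 2)

/-- The unnormalised entropy deficit (in nats) of a pair of masses, `0` at `a = b`. -/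
def pairDeficit (a b : ℝ) : ℝ := (a + b) * biasDeficit ((a - b) / (a + b))

section Deficit

open Real

lemma biasDeficit_neg (s : ℝ) : biasDeficit (-s) = biasDeficit s := by
  unfold biasDeficit
  rw [← binEntropy_one_sub ((1 + s) / 2)]
  ring_nf

lemma biasDeficit_nonneg (s : ℝ) : 0 ≤ biasDeficit s :=
  sub_nonneg.2 binEntropy_le_log_two

lemma biasDeficit_one : biasDeficit 1 = log 2 := by
  norm_num [biasDeficit]

lemma biasDeficit_zero : biasDeficit 0 = 0 := by
  have h : binEntropy ((1 + 0) / 2 : ℝ) = log 2 := by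
    rw [add_zero, one_div, binEntropy_two_inv]
  rw [biasDeficit, h, sub_self]

lemma hasSum_biasDeficit {s : ℝ} (hs : |s| < 1) :
    HasSum (fun n : ℕ => 1 / ((2 * n + 1) * (2 * n + 2)) * (s ^ 2) ^ (n + 1))
      (biasDeficit s) := by
  obtain ⟨h₁, h₂⟩ := abs_lt.1 hs
  have hodd := (hasSum_log_sub_log_of_abs_lt_one hs).mul_left (s / 2)
  have hsq : |s ^ 2| < 1 := by
    rw [abs_pow]; exact pow_lt_one₀ (abs_nonneg s) hs two_ne_zero
  have heven := (hasSum_pow_div_log_of_abs_lt_one hsq).mul_left (1 / 2)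
  have hlog : log (1 - s ^ 2) = log (1 + s) + log (1 - s) := by
    rw [← log_mul (by linarith) (by linarith)]; ring_nf
  have hplus : log ((1 + s) / 2) = log (1 + s) - log 2 := log_div (by linarith) two_ne_zero
  have hminus : log (1 - (1 + s) / 2) = log (1 - s) - log 2 := by
    rw [← log_div (by linarith) two_ne_zero]; ring_nf
  have hval : biasDeficit s =
      s / 2 * (log (1 + s) - log (1 - s)) - 1 / 2 * -log (1 - s ^ 2) := by
    rw [biasDeficit, binEntropy_eq_negMulLog_add_negMulLog_one_sub, negMulLog, negMulLog, hlog,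
      hplus, hminus]
    ring
  rw [hval]
  refine (congrArg (HasSum · _) (funext fun n => ?_)).mpr (hodd.sub heven)
  have h₃ : (2 * n + 1 : ℝ) ≠ 0 := by positivity
  have h₄ : (n + 1 : ℝ) ≠ 0 := by positivity
  have h₅ : (2 * n + 2 : ℝ) = 2 * (n + 1) := by ring
  rw [h₅]
  field_simp
  ring

lemma sum_coeff_le_log_two (N : ℕ) :
    ∑ n ∈ Finset.range N, 1 / ((2 * n + 1) * (2 * n + 2) : ℝ) ≤ log 2 := by
  have hcont : Continuous biasDeficit := by
    unfold biasDeficit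
    fun_prop
  have hpoly : Continuous fun s : ℝ =>
      ∑ n ∈ Finset.range N, 1 / ((2 * n + 1) * (2 * n + 2) : ℝ) * (s ^ 2) ^ (n + 1) := by
    fun_prop
  have hle : ∀ s ∈ Set.Ioo (0 : ℝ) 1,
      ∑ n ∈ Finset.range N, 1 / ((2 * n + 1) * (2 * n + 2) : ℝ) * (s ^ 2) ^ (n + 1)
        ≤ biasDeficit s := fun s hs =>
    sum_le_hasSum _ (fun n _ => by positivity)
      (hasSum_biasDeficit (abs_lt.2 ⟨by linarith [hs.1], hs.2⟩))
  have h := le_on_closure hle hpoly.continuousOn hcont.continuousOn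
    (x := 1) (by rw [closure_Ioo zero_ne_one]; simp)
  simpa [biasDeficit_one] using h

/-- A weighted Chebyshev sum inequality for two antitone sequences. -/
lemma sum_mul_sum_le_of_antitone (c f g : ℕ → ℝ) (hc : ∀ n, 0 ≤ c n) (hf : Antitone f)
    (hg : Antitone g) (N : ℕ) :
    (∑ n ∈ Finset.range N, c n * f n) * ∑ n ∈ Finset.range N, c n * g n ≤
      (∑ n ∈ Finset.range N, c n) * ∑ n ∈ Finset.range N, c n * (f n * g n) := by
  have hpos : 0 ≤ ∑ i ∈ Finset.range N, ∑ j ∈ Finset.range N,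
      c i * c j * ((f i - f j) * (g i - g j)) := by
    refine Finset.sum_nonneg fun i _ => Finset.sum_nonneg fun j _ =>
      mul_nonneg (mul_nonneg (hc i) (hc j)) ?_
    rcases le_total i j with h | h
    · exact mul_nonneg (sub_nonneg.2 (hf h)) (sub_nonneg.2 (hg h))
    · exact mul_nonneg_of_nonpos_of_nonpos (sub_nonpos.2 (hf h)) (sub_nonpos.2 (hg h))
  have hexp : ∑ i ∈ Finset.range N, ∑ j ∈ Finset.range N,
      c i * c j * ((f i - f j) * (g i - g j)) =
      (∑ n ∈ Finset.range N, c n * (f n * g n)) * (∑ n ∈ Finset.range N, c n)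
      + (∑ n ∈ Finset.range N, c n) * (∑ n ∈ Finset.range N, c n * (f n * g n))
      - (∑ n ∈ Finset.range N, c n * f n) * (∑ n ∈ Finset.range N, c n * g n)
      - (∑ n ∈ Finset.range N, c n * g n) * (∑ n ∈ Finset.range N, c n * f n) := by
    simp only [Finset.sum_mul_sum, ← Finset.sum_add_distrib, ← Finset.sum_sub_distrib]
    exact Finset.sum_congr rfl fun i _ => Finset.sum_congr rfl fun j _ => by ring
  linarith

lemma biasDeficit_mul_le {s t : ℝ} (hs : |s| ≤ 1) (ht : |t| ≤ 1) :
    biasDeficit s * biasDeficit t ≤ log 2 * biasDeficit (s * t) := by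
  have habs : ∀ x : ℝ, |x| = 1 → ∀ y, biasDeficit (x * y) = biasDeficit y ∧
      biasDeficit x = log 2 := by
    intro x hx y
    rcases eq_or_eq_neg_of_abs_eq hx with rfl | rfl
    · simp [biasDeficit_one]
    · simp [biasDeficit_one, biasDeficit_neg]
  rcases hs.eq_or_lt with hs | hs
  · rw [(habs s hs t).1, (habs s hs t).2]
  rcases ht.eq_or_lt with ht | ht
  · rw [mul_comm s t, (habs t ht s).1, (habs t ht s).2, mul_comm]
  have hst : |s * t| < 1 := by
    rw [abs_mul]; exact mul_lt_one_of_nonneg_of_lt_one_left (abs_nonneg s) hs ht.le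
  have hanti : ∀ {x : ℝ}, |x| < 1 → Antitone fun n : ℕ => (x ^ 2) ^ (n + 1) := by
    intro x hx m n hmn
    exact pow_le_pow_of_le_one (sq_nonneg x) ((sq_le_one_iff_abs_le_one x).2 hx.le) (by omega)
  refine le_of_tendsto_of_tendsto'
    ((hasSum_biasDeficit hs).tendsto_sum_nat.mul (hasSum_biasDeficit ht).tendsto_sum_nat)
    ((hasSum_biasDeficit hst).tendsto_sum_nat.const_mul (log 2)) fun N => ?_
  refine (sum_mul_sum_le_of_antitone _ _ _ (fun n => by positivity) (hanti hs) (hanti ht) N).trans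
    ?_
  simp only [mul_pow]
  exact mul_le_mul_of_nonneg_right (sum_coeff_le_log_two N)
    (Finset.sum_nonneg fun n _ => by positivity)

lemma pairDeficit_comm (a b : ℝ) : pairDeficit a b = pairDeficit b a := by
  rw [pairDeficit, pairDeficit, ← biasDeficit_neg, ← neg_div, neg_sub, add_comm]

lemma pairDeficit_mul_left (c a b : ℝ) :
    pairDeficit (c * a) (c * b) = c * pairDeficit a b := by
  rcases eq_or_ne c 0 with rfl | hc
  · simp [pairDeficit]
  · rw [pairDeficit, pairDeficit, ← mul_sub, ← mul_add, mul_div_mul_left _ _ hc, mul_assoc]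

lemma pairDeficit_self (a : ℝ) : pairDeficit a a = 0 := by
  simp [pairDeficit, biasDeficit_zero]

lemma pairDeficit_zero_right (a : ℝ) : pairDeficit a 0 = a * log 2 := by
  rcases eq_or_ne a 0 with rfl | ha
  · simp [pairDeficit]
  · simp [pairDeficit, ha, biasDeficit_one]

lemma pairDeficit_nonneg {a b : ℝ} (ha : 0 ≤ a) (hb : 0 ≤ b) : 0 ≤ pairDeficit a b :=
  mul_nonneg (add_nonneg ha hb) (biasDeficit_nonneg _)

lemma pairDeficit_le {a b : ℝ} (ha : 0 ≤ a) (hb : 0 ≤ b) :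
    pairDeficit a b ≤ (a + b) * log 2 := by
  refine mul_le_mul_of_nonneg_left (sub_le_self _ ?_) (add_nonneg ha hb)
  rcases (add_nonneg ha hb).eq_or_lt with h | h
  · rw [← h, div_zero]
    exact binEntropy_nonneg (by norm_num) (by norm_num)
  · have h₁ : (1 + (a - b) / (a + b)) / 2 = a / (a + b) := by field_simp; ring
    rw [h₁]
    exact binEntropy_nonneg (by positivity) ((div_le_one h).2 (by linarith))

lemma pairDeficit_pos {a b : ℝ} (ha : 0 ≤ a) (hb : 0 ≤ b) (hab : a ≠ b) :
    0 < pairDeficit a b := by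
  have hpos : 0 < a + b := by
    rcases ha.eq_or_lt with rfl | ha
    · simpa using hb.lt_of_ne hab
    · linarith
  refine mul_pos hpos (sub_pos.2 (binEntropy_lt_log_two.2 fun h => hab ?_))
  field_simp at h
  linarith

lemma pairDeficit_eq {a b : ℝ} (ha : 0 ≤ a) (hb : 0 ≤ b) :
    pairDeficit a b = negMulLog (a + b) - negMulLog a - negMulLog b + (a + b) * log 2 := by
  rcases (add_nonneg ha hb).eq_or_lt with h | h
  · obtain rfl : a = 0 := by linarith
    obtain rfl : b = 0 := by linarith
    simp [pairDeficit]
  · have h₁ : (1 + (a - b) / (a + b)) / 2 = (a + b)⁻¹ * a := by field_simp; ring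
    have h₂ : 1 - (a + b)⁻¹ * a = (a + b)⁻¹ * b := by field_simp; ring
    rw [pairDeficit, biasDeficit, h₁, binEntropy_eq_negMulLog_add_negMulLog_one_sub, h₂,
      negMulLog_mul, negMulLog_mul]
    simp only [negMulLog, log_inv]
    field_simp
    ring

lemma pairDeficit_mul_le {a b u v : ℝ} (ha : 0 ≤ a) (hb : 0 ≤ b) (hu : 0 ≤ u) (hv : 0 ≤ v) :
    pairDeficit a b * pairDeficit u v ≤
      log 2 * pairDeficit (a * u + b * v) (b * u + a * v) := by
  have habs : ∀ {x y : ℝ}, 0 ≤ x → 0 ≤ y → |(x - y) / (x + y)| ≤ 1 := by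
    intro x y hx hy
    rw [abs_div, abs_of_nonneg (add_nonneg hx hy)]
    exact div_le_one_of_le₀ (abs_le.2 ⟨by linarith, by linarith⟩) (add_nonneg hx hy)
  have hsum : a * u + b * v + (b * u + a * v) = (a + b) * (u + v) := by ring
  have hdiff : a * u + b * v - (b * u + a * v) = (a - b) * (u - v) := by ring
  have key := mul_le_mul_of_nonneg_left (biasDeficit_mul_le (habs ha hb) (habs hu hv))
    (mul_nonneg (add_nonneg ha hb) (add_nonneg hu hv))
  rw [pairDeficit, pairDeficit, pairDeficit, hsum, hdiff, mul_div_mul_comm]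
  linarith

lemma ent_mul_log_two [Fintype α] (p : α → ℝ) : ent p * log 2 = ∑ a, negMulLog (p a) := by
  have h2 : log 2 ≠ 0 := (log_pos one_lt_two).ne'
  rw [ent, Finset.sum_mul]
  refine Finset.sum_congr rfl fun a _ => ?_
  rw [logb, negMulLog]
  field_simp

end Deficit

section MutualInformation

open Real

lemma sum_negMulLog_half : ∑ _b : Bool, negMulLog (1 / 2 : ℝ) = log 2 := by
  simp only [Fintype.sum_bool, negMulLog, one_div, log_inv]
  ring

/-- Mutual information with a uniform bit as second coordinate. -/
lemma mi_mul_log_two_of_uniform [Fintype α] (p : α × Bool → ℝ) (hp : ∀ x, 0 ≤ p x)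
    (hunif : ∀ b, margB p b = 1 / 2) :
    mi p * log 2 = ∑ x, pairDeficit (p (x, true)) (p (x, false)) := by
  have hsum : ∑ x, (p (x, true) + p (x, false)) = 1 := by
    have ht := hunif true
    have hf := hunif false
    simp only [margB] at ht hf
    rw [Finset.sum_add_distrib, ht, hf]
    norm_num
  rw [mi, sub_mul, add_mul, ent_mul_log_two, ent_mul_log_two, ent_mul_log_two,
    Fintype.sum_prod_type]
  simp only [hunif, sum_negMulLog_half]
  rw [Finset.sum_congr rfl fun x _ => pairDeficit_eq (hp (x, true)) (hp (x, false)),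
    Finset.sum_add_distrib, ← Finset.sum_mul, hsum, one_mul, add_sub_right_comm,
    ← Finset.sum_sub_distrib]
  congr 1
  refine Finset.sum_congr rfl fun x _ => ?_
  simp only [margA, Fintype.sum_bool]
  ring

variable [Fintype γ]

/-- Mutual information between a uniform bit and the output of a channel. -/
lemma mi_jointYZ_mul_log_two [Fintype α] (p : α × Bool → ℝ) (q : Bool → γ → ℝ)
    (hq : IsChannel q) (hunif : ∀ b, margB p b = 1 / 2) :
    mi (jointYZ p q) * log 2 = ∑ z, pairDeficit (q true z / 2) (q false z / 2) := by
  have hA : margA (jointYZ p q) = fun _ => 1 / 2 := by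
    funext b
    simp [margA, jointYZ, hunif, ← Finset.mul_sum, hq.2]
  have hsum : ∑ z, (q true z / 2 + q false z / 2) = 1 := by
    rw [Finset.sum_add_distrib, ← Finset.sum_div, ← Finset.sum_div, hq.2, hq.2]
    norm_num
  rw [mi, sub_mul, add_mul, ent_mul_log_two, ent_mul_log_two, ent_mul_log_two, hA,
    sum_negMulLog_half, Fintype.sum_prod_type_right,
    Finset.sum_congr rfl fun z _ => pairDeficit_eq (div_nonneg (hq.1 true z) zero_le_two)
      (div_nonneg (hq.1 false z) zero_le_two),
    Finset.sum_add_distrib, ← Finset.sum_mul, hsum, one_mul, add_comm (log 2),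
    add_sub_right_comm, ← Finset.sum_sub_distrib]
  congr 1
  refine Finset.sum_congr rfl fun z _ => ?_
  simp only [margB, jointYZ, Fintype.sum_bool, show ∀ b, ∑ a, p (a, b) = 1 / 2 from hunif]
  ring_nf

/-- The involution `x ↦ -x` as a permutation of the alphabet. -/
def negXkEquiv (k : ℕ) : Equiv.Perm (Xk k) :=
  Function.Involutive.toPerm negXk fun x => Subtype.ext (neg_neg x.1)

lemma IsBISO.apply_negXk {k : ℕ} {p : Xk k × Bool → ℝ} (h : IsBISO p)
    (hunif : ∀ b, margB p b = 1 / 2) (x : Xk k) :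
    p (negXk x, true) = p (x, false) ∧ p (negXk x, false) = p (x, true) := by
  have h' : ∀ x, p (x, true) = p (negXk x, false) := fun x => by
    have := h x
    rw [hunif, hunif] at this
    linarith
  have hneg : negXk (negXk x) = x := Subtype.ext (neg_neg x.1)
  exact ⟨by rw [h', hneg], (h' x).symm⟩

/-- Mutual information across a BISO channel, when its uniform input is observed through `q`. -/
lemma mi_jointXZ_mul_log_two {k : ℕ} (p : Xk k × Bool → ℝ) (hp : ∀ x, 0 ≤ p x)
    (q : Bool → γ → ℝ) (hq : IsChannel q) (hunif : ∀ b, margB p b = 1 / 2) (hB : IsBISO p) :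
    mi (jointXZ p q) * log 2 = ∑ x, ∑ z,
      pairDeficit (p (x, true) * (q true z / 2) + p (x, false) * (q false z / 2))
        (p (x, false) * (q true z / 2) + p (x, true) * (q false z / 2)) := by
  set w : γ → ℝ := fun z => q true z / 2 + q false z / 2 with hw
  set m : Xk k → ℝ := fun x => p (x, true) + p (x, false) with hm
  have hwsum : ∑ z, w z = 1 := by
    rw [hw, Finset.sum_add_distrib, ← Finset.sum_div, ← Finset.sum_div, hq.2, hq.2]
    norm_num
  have hmsum : ∑ x, m x = 1 := by
    have ht := hunif true
    have hf := hunif false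
    simp only [margB] at ht hf
    rw [hm, Finset.sum_add_distrib, ht, hf]
    norm_num
  have hA : margA (jointXZ p q) = m := by
    funext x
    simp [margA, jointXZ, hm, Finset.sum_add_distrib, ← Finset.mul_sum, hq.2]
  have hBm : margB (jointXZ p q) = w := by
    funext z
    have ht := hunif true
    have hf := hunif false
    simp only [margB] at ht hf
    simp only [margB, jointXZ, Fintype.sum_bool, Finset.sum_add_distrib, ← Finset.sum_mul, ht, hf,
      hw]
    ring
  have hnn : ∀ x b z, 0 ≤ p x * (q b z / 2) := fun x b z =>
    mul_nonneg (hp x) (div_nonneg (hq.1 b z) zero_le_two)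
  have hdef : ∀ x z,
      pairDeficit (p (x, true) * (q true z / 2) + p (x, false) * (q false z / 2))
        (p (x, false) * (q true z / 2) + p (x, true) * (q false z / 2)) =
      w z * negMulLog (m x) + m x * negMulLog (w z)
        - (negMulLog (jointXZ p q (x, z)) + negMulLog (jointXZ p q (negXk x, z))) / 2 := by
    intro x z
    have hscale : ∀ a b : ℝ, pairDeficit a b = pairDeficit (2 * a) (2 * b) / 2 := fun a b => by
      rw [pairDeficit_mul_left]; ring
    have h₁ : 2 * (p (x, true) * (q true z / 2) + p (x, false) * (q false z / 2)) =
        jointXZ p q (x, z) := by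
      simp only [jointXZ, Fintype.sum_bool]; ring
    have h₂ : 2 * (p (x, false) * (q true z / 2) + p (x, true) * (q false z / 2)) =
        jointXZ p q (negXk x, z) := by
      simp only [jointXZ, Fintype.sum_bool, (hB.apply_negXk hunif x).1,
        (hB.apply_negXk hunif x).2]
      ring
    have h₃ : jointXZ p q (x, z) + jointXZ p q (negXk x, z) = 2 * (m x * w z) := by
      rw [← h₁, ← h₂, hm, hw]; ring
    rw [hscale, h₁, h₂, pairDeficit_eq, h₃, negMulLog_mul, negMulLog_mul,
      show negMulLog 2 = -(2 * log 2) by simp [negMulLog]]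
    · ring
    · rw [← h₁]; linarith [hnn (x, true) true z, hnn (x, false) false z]
    · rw [← h₂]; linarith [hnn (x, false) true z, hnn (x, true) false z]
  have hsymm : ∑ x, ∑ z, negMulLog (jointXZ p q (negXk x, z)) =
      ∑ x, ∑ z, negMulLog (jointXZ p q (x, z)) :=
    Equiv.sum_comp (negXkEquiv k) fun x => ∑ z, negMulLog (jointXZ p q (x, z))
  rw [mi, sub_mul, add_mul, ent_mul_log_two, ent_mul_log_two, ent_mul_log_two, hA, hBm,
    Fintype.sum_prod_type]
  simp only [hdef, Finset.sum_sub_distrib, Finset.sum_add_distrib, ← Finset.sum_mul,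
    ← Finset.mul_sum, ← Finset.sum_div, hwsum, hmsum, hsymm]
  ring

/-- The erasure channel keeping its binary input with probability `l`. -/
def erasure (l : ℝ) : Bool → Fin 3 → ℝ :=
  fun b => if b then ![l, 0, 1 - l] else ![0, l, 1 - l]

lemma isChannel_erasure {l : ℝ} (h0 : 0 ≤ l) (h1 : l ≤ 1) : IsChannel (erasure l) := by
  refine ⟨fun b z => ?_, fun b => ?_⟩
  · cases b <;> fin_cases z <;> simp [erasure, h0, h1]
  · cases b <;> simp [erasure, Fin.sum_univ_three]

lemma mi_jointYZ_erasure [Fintype α] (p : α × Bool → ℝ) (hunif : ∀ b, margB p b = 1 / 2)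
    {l : ℝ} (h0 : 0 ≤ l) (h1 : l ≤ 1) : mi (jointYZ p (erasure l)) = l := by
  refine mul_right_cancel₀ (log_pos one_lt_two).ne' ?_
  rw [mi_jointYZ_mul_log_two p _ (isChannel_erasure h0 h1) hunif, Fin.sum_univ_three]
  simp only [erasure, if_true, Bool.false_eq_true, if_false, Matrix.cons_val_zero,
    Matrix.cons_val_one, Matrix.cons_val, zero_div, pairDeficit_self,
    pairDeficit_comm 0, pairDeficit_zero_right]
  ring

lemma mi_jointXZ_erasure {k : ℕ} (p : Xk k × Bool → ℝ) (hp : ∀ x, 0 ≤ p x)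
    (hunif : ∀ b, margB p b = 1 / 2) (hB : IsBISO p) {l : ℝ} (h0 : 0 ≤ l) (h1 : l ≤ 1) :
    mi (jointXZ p (erasure l)) = l * mi p := by
  refine mul_right_cancel₀ (log_pos one_lt_two).ne' ?_
  rw [mi_jointXZ_mul_log_two p hp _ (isChannel_erasure h0 h1) hunif hB, mul_assoc,
    mi_mul_log_two_of_uniform p hp hunif, Finset.mul_sum]
  refine Finset.sum_congr rfl fun x _ => ?_
  simp only [Fin.sum_univ_three, erasure, if_true, Bool.false_eq_true, if_false,
    Matrix.cons_val_zero, Matrix.cons_val_one, Matrix.cons_val, zero_div, mul_zero, add_zero,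
    zero_add]
  rw [pairDeficit_comm (p (x, false) * (l / 2)), mul_comm _ (l / 2), mul_comm _ (l / 2),
    pairDeficit_mul_left, add_comm (p (x, false) * _), pairDeficit_self]
  ring

/-- Strong data processing across a BISO channel with uniform input. -/
lemma mi_mul_mi_jointYZ_le {k : ℕ} (p : Xk k × Bool → ℝ) (hp : ∀ x, 0 ≤ p x)
    (q : Bool → γ → ℝ) (hq : IsChannel q) (hunif : ∀ b, margB p b = 1 / 2) (hB : IsBISO p) :
    mi p * mi (jointYZ p q) ≤ mi (jointXZ p q) := by
  have h2 : 0 < log 2 := log_pos one_lt_two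
  have key : (mi p * log 2) * (mi (jointYZ p q) * log 2) ≤
      log 2 * (mi (jointXZ p q) * log 2) := by
    rw [mi_mul_log_two_of_uniform p hp hunif, mi_jointYZ_mul_log_two p q hq hunif,
      mi_jointXZ_mul_log_two p hp q hq hunif hB, Finset.sum_mul_sum, Finset.mul_sum]
    refine Finset.sum_le_sum fun x _ => ?_
    rw [Finset.mul_sum]
    exact Finset.sum_le_sum fun z _ => pairDeficit_mul_le (hp _) (hp _)
      (div_nonneg (hq.1 true z) zero_le_two) (div_nonneg (hq.1 false z) zero_le_two)
  refine le_of_mul_le_mul_right ?_ (mul_pos h2 h2)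
  linarith

lemma mi_jointYZ_le_one [Fintype α] (p : α × Bool → ℝ) (q : Bool → γ → ℝ)
    (hq : IsChannel q) (hunif : ∀ b, margB p b = 1 / 2) : mi (jointYZ p q) ≤ 1 := by
  refine le_of_mul_le_mul_right ?_ (log_pos one_lt_two)
  rw [mi_jointYZ_mul_log_two p q hq hunif]
  refine (Finset.sum_le_sum fun z _ => pairDeficit_le (div_nonneg (hq.1 true z) zero_le_two)
    (div_nonneg (hq.1 false z) zero_le_two)).trans ?_
  rw [← Finset.sum_mul, Finset.sum_add_distrib, ← Finset.sum_div, ← Finset.sum_div, hq.2, hq.2]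
  norm_num

lemma mi_pos_of_dependent [Fintype α] (p : α × Bool → ℝ) (hp : ∀ x, 0 ≤ p x)
    (hunif : ∀ b, margB p b = 1 / 2) (hdep : ¬ ∀ x y, p (x, y) = margA p x * margB p y) :
    0 < mi p := by
  refine pos_of_mul_pos_left ?_ (log_pos one_lt_two).le
  rw [mi_mul_log_two_of_uniform p hp hunif]
  obtain ⟨x, hx⟩ : ∃ x, p (x, true) ≠ p (x, false) := by
    by_contra! h
    refine hdep fun x y => ?_
    rw [hunif, margA, Fintype.sum_bool, h x]
    cases y <;> linarith [h x]
  exact Finset.sum_pos' (fun x _ => pairDeficit_nonneg (hp _) (hp _))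
    ⟨x, Finset.mem_univ x, pairDeficit_pos (hp _) (hp _) hx⟩

end MutualInformation

/-- If the reverse channel `P_{X|Y}` is BISO and `Y` is uniform on
`{0,1}` (with `X, Y` not independent), then for every `ε ≥ 0`,
`g_ε(X;Y) = min{ε, I(X;Y)} / I(X;Y)`. -/
theorem stmt15 {k : ℕ} (p : Xk k × Bool → ℝ) (hp : IsPMF p)
    (hunif : ∀ b, margB p b = 1 / 2)
    (hdep : ¬ ∀ x y, p (x, y) = margA p x * margB p y)
    (hBISO : IsBISO p) :
    ∀ ε : ℝ, 0 ≤ ε → g p ε = min ε (mi p) / mi p := by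
  intro ε hε
  have hI : 0 < mi p := mi_pos_of_dependent p hp.1 hunif hdep
  have h0 : 0 ≤ min ε (mi p) / mi p := div_nonneg (le_min hε hI.le) hI.le
  have h1 : min ε (mi p) / mi p ≤ 1 := (div_le_one hI).2 (min_le_right _ _)
  refine IsGreatest.csSup_eq ⟨⟨3, erasure (min ε (mi p) / mi p), isChannel_erasure h0 h1, ?_,
    (mi_jointYZ_erasure p hunif h0 h1).symm⟩, ?_⟩
  · rw [mi_jointXZ_erasure p hp.1 hunif hBISO h0 h1, div_mul_cancel₀ _ hI.ne']
    exact min_le_left _ _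
  · rintro r ⟨n, q, hq, hle, rfl⟩
    rw [le_div_iff₀ hI, le_min_iff]
    refine ⟨?_, mul_le_of_le_one_left hI.le (mi_jointYZ_le_one p q hq hunif)⟩
    rw [mul_comm]
    exact (mi_mul_mi_jointYZ_le p hp.1 q hq hunif hBISO).trans hle

end RatePrivacy
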